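/- Fix k ∈ ℕ. For n ∈ ℕ let ε_n := 1/√n and let F_n := {(x,z) ∈ {0,1}^n × {0,1}^n : ∑_{i=1}^n x_i + (1/n)∑_{j=1}^n z_j ≥ 1 + ε_n}. Then: (a) min{∑_i x_i + (1/√n)∑_j z_j : (x,z) ∈ F_n} = 2 for all n ≥ 2; and (b) for all sufficiently large n, the point (x̄, z̄) with x̄_i = (1+ε_n)/n and z̄_j = k/n for all i,j satisfies the constraint ∑_i x̄_i + (1/n)∑_j z̄_j ≥ 1 + ε_n, every knapsack cover inequality of F_n, and every valid inequality for F_n of pitch at most k. Consequently the integrality gap of the relaxation with all knapsack cover inequalities plus all inequalities of pitch at most k is at least 2/(1 + (k+1)/√n), which tends to 2. -/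

import Mathlib

open Finset

/-- The pitch of the inequality `∑ i ∈ T, w i * v i ≥ β`: the least `k` such that
every `k`-element subset `S ⊆ T` satisfies `∑ i ∈ S, w i ≥ β`. -/
noncomputable def pitch {ι : Type*} (T : Finset ι) (w : ι → ℝ) (β : ℝ) : ℕ :=
  sInf {k : ℕ | ∀ S ⊆ T, S.card = k → β ≤ ∑ i ∈ S, w i}

/-- Coefficients of the covering constraint `∑ x_i + (1/n) ∑ z_j ≥ 1 + ε_n`:
`1` on the `x`-coordinates (`Sum.inl`) and `1/n` on the `z`-coordinates (`Sum.inr`). -/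
noncomputable def aF (n : ℕ) : Fin n ⊕ Fin n → ℝ :=
  Sum.elim (fun _ => 1) (fun _ => 1 / (n : ℝ))

/-- `ε_n = 1/√n`. -/
noncomputable def epsN (n : ℕ) : ℝ := 1 / Real.sqrt n

/-- `F_n = {(x,z) ∈ {0,1}^n × {0,1}^n : ∑ x_i + (1/n) ∑ z_j ≥ 1 + ε_n}`. -/
noncomputable def Fcov (n : ℕ) : Set (Fin n ⊕ Fin n → ℝ) :=
  {v | (∀ i, v i = 0 ∨ v i = 1) ∧ 1 + epsN n ≤ ∑ i, aF n i * v i}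

/-- The objective `∑ x_i + (1/√n) ∑ z_j`. -/
noncomputable def objF (n : ℕ) (v : Fin n ⊕ Fin n → ℝ) : ℝ :=
  ∑ i : Fin n, v (Sum.inl i) + (1 / Real.sqrt n) * ∑ j : Fin n, v (Sum.inr j)

/-- The fractional point `x̄_i = (1+ε_n)/n`, `z̄_j = k/n`. -/
noncomputable def ptF (n k : ℕ) : Fin n ⊕ Fin n → ℝ :=
  Sum.elim (fun _ => (1 + epsN n) / n) (fun _ => (k : ℝ) / n)

/-- The relaxation of `F_n` given by the box, the covering constraint, all knapsack cover
inequalities and all valid inequalities of pitch at most `k`. -/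
noncomputable def RelF (n k : ℕ) : Set (Fin n ⊕ Fin n → ℝ) :=
  {v | (∀ i, 0 ≤ v i ∧ v i ≤ 1) ∧ 1 + epsN n ≤ ∑ i, aF n i * v i ∧
    (∀ S : Finset (Fin n ⊕ Fin n), 0 < 1 + epsN n - ∑ i ∈ S, aF n i →
      1 + epsN n - ∑ i ∈ S, aF n i
        ≤ ∑ i ∈ Sᶜ, min (aF n i) (1 + epsN n - ∑ j ∈ S, aF n j) * v i) ∧
    (∀ (T : Finset (Fin n ⊕ Fin n)) (w : Fin n ⊕ Fin n → ℝ) (β : ℝ),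
      (∀ i ∈ T, 0 < w i) → 0 < β →
      (∀ u ∈ Fcov n, β ≤ ∑ i ∈ T, w i * u i) →
      pitch T w β ≤ k →
      β ≤ ∑ i ∈ T, w i * v i)}

lemma chunk16 {ι : Type*} [DecidableEq ι] (f : ι → ℝ) (hf : ∀ i, 0 ≤ f i) (m : ℕ) (c : ℝ) :
    ∀ (q : ℕ) (A : Finset ι), (∀ Z ⊆ A, Z.card = m → c ≤ ∑ i ∈ Z, f i) → q * m ≤ A.card →
      (q : ℝ) * c ≤ ∑ i ∈ A, f i := by
  intro q
  induction q with
  | zero =>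
    intro A _ _
    simpa using Finset.sum_nonneg (fun i _ => hf i)
  | succ q ih =>
    intro A hA hc
    have h1 : m ≤ A.card := by nlinarith
    obtain ⟨Z, hZ, hZc⟩ := Finset.exists_subset_card_eq h1
    have h2 := ih (A \ Z) (fun Y hY => hA Y (hY.trans Finset.sdiff_subset)) (by
      rw [Finset.card_sdiff_of_subset hZ, hZc]
      have : (q + 1) * m = q * m + m := by ring
      omega)
    have h3 := hA Z hZ hZc
    have h4 := Finset.sum_sdiff hZ (f := f)
    push_cast
    linarith

lemma sumaF16 (n : ℕ) (P Q : Finset (Fin n)) :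
    ∑ i ∈ P.disjSum Q, aF n i = (P.card : ℝ) + Q.card * (1 / n) := by
  rw [Finset.sum_disjSum]
  simp [aF]

lemma eps16 (n : ℕ) (hn : 2 ≤ n) : 0 < epsN n ∧ epsN n ≤ 1 ∧ epsN n * epsN n = 1 / n ∧
    epsN n * n = Real.sqrt n := by
  have h0 : (2:ℝ) ≤ n := by exact_mod_cast hn
  have hs : (1:ℝ) ≤ Real.sqrt n := Real.one_le_sqrt.mpr (by linarith)
  have hss : Real.sqrt n * Real.sqrt n = n := Real.mul_self_sqrt (by linarith)
  unfold epsN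
  refine ⟨by positivity, ?_, ?_, ?_⟩
  · rw [div_le_one (by linarith)]; exact hs
  · rw [div_mul_div_comm, hss]; norm_num
  · rw [div_mul_eq_mul_div, div_eq_iff (by positivity)]; linarith

lemma partA16 (n : ℕ) (hn : 2 ≤ n) : IsLeast {r : ℝ | ∃ v ∈ Fcov n, r = objF n v} 2 := by
  obtain ⟨he0, he1, he2, he3⟩ := eps16 n hn
  have hn0 : (2:ℝ) ≤ n := by exact_mod_cast hn
  constructor
  · let i0 : Fin n := ⟨0, by omega⟩
    let i1 : Fin n := ⟨1, by omega⟩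
    have hne : i0 ≠ i1 := by simp [i0, i1]
    have hs : ∑ i : Fin n, (if i = i0 ∨ i = i1 then (1:ℝ) else 0) = 2 := by
      rw [← Finset.sum_filter, Finset.sum_const]
      have : (Finset.univ.filter (fun i : Fin n => i = i0 ∨ i = i1)) = {i0, i1} := by
        ext; simp
      rw [this, Finset.card_pair hne]; norm_num
    refine ⟨Sum.elim (fun i => if i = i0 ∨ i = i1 then 1 else 0) (fun _ => 0), ⟨?_, ?_⟩, ?_⟩
    · rintro (i | i)
      · simp only [Sum.elim_inl]; split_ifs <;> simp
      · simp
    · rw [Fintype.sum_sum_type]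
      simp only [aF, Sum.elim_inl, Sum.elim_inr, one_mul, mul_zero, Finset.sum_const_zero, add_zero]
      rw [hs]; linarith
    · unfold objF
      simp only [Sum.elim_inl, Sum.elim_inr, Finset.sum_const_zero, mul_zero, add_zero]
      rw [hs]
  · rintro r ⟨v, ⟨hv, hc⟩, rfl⟩
    rw [Fintype.sum_sum_type] at hc
    simp only [aF, Sum.elim_inl, Sum.elim_inr, one_mul, ← Finset.mul_sum] at hc
    change 2 ≤ ∑ i : Fin n, v (Sum.inl i) + epsN n * ∑ j : Fin n, v (Sum.inr j)
    have hX : ∃ X : ℕ, ∑ i : Fin n, v (Sum.inl i) = X := by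
      refine ⟨(Finset.univ.filter (fun i : Fin n => v (Sum.inl i) = 1)).card, ?_⟩
      rw [Finset.card_filter]
      push_cast
      refine Finset.sum_congr rfl fun i _ => ?_
      rcases hv (Sum.inl i) with h | h <;> simp [h]
    have hZ0 : 0 ≤ ∑ j : Fin n, v (Sum.inr j) :=
      Finset.sum_nonneg fun j _ => by rcases hv (Sum.inr j) with h | h <;> simp [h]
    have hZ1 : ∑ j : Fin n, v (Sum.inr j) ≤ n := by
      calc _ ≤ ∑ j : Fin n, (1:ℝ) := Finset.sum_le_sum fun j _ => by
            rcases hv (Sum.inr j) with h | h <;> simp [h]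
        _ = n := by simp
    obtain ⟨X, hX⟩ := hX
    rw [hX] at hc ⊢
    set Z := ∑ j : Fin n, v (Sum.inr j)
    have h1n : 1 / (n:ℝ) * n = 1 := by field_simp
    have hZ1' : 1 / (n:ℝ) * Z ≤ 1 := by
      calc _ ≤ 1 / (n:ℝ) * n := mul_le_mul_of_nonneg_left hZ1 (by positivity)
        _ = 1 := h1n
    rcases Nat.lt_or_ge X 2 with h | h
    · interval_cases X
      · norm_num at hc hZ1'; linarith
      · rw [← he2] at hc
        push_cast at hc ⊢
        have : epsN n * 1 ≤ epsN n * (epsN n * Z) := by linarith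
        have : 1 ≤ epsN n * Z := by
          have h5 : epsN n * 1 ≤ epsN n * (epsN n * Z) := this
          exact le_of_mul_le_mul_left h5 he0
        linarith
    · have : (2:ℝ) ≤ X := by exact_mod_cast h
      have := mul_nonneg he0.le hZ0
      linarith

lemma kc16 (n k : ℕ) (hn : 3 ≤ n) (S : Finset (Fin n ⊕ Fin n))
    (hS : 0 < 1 + epsN n - ∑ i ∈ S, aF n i) :
    1 + epsN n - ∑ i ∈ S, aF n i
        ≤ ∑ i ∈ Sᶜ, min (aF n i) (1 + epsN n - ∑ j ∈ S, aF n j) * ptF n k i := by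
  obtain ⟨he0, he1, he2, he3⟩ := eps16 n (by omega)
  have hn0 : (3:ℝ) ≤ n := by exact_mod_cast hn
  set b := 1 + epsN n - ∑ i ∈ S, aF n i with hb
  have hsum : ∑ i ∈ S, aF n i = (S.toLeft.card : ℝ) + S.toRight.card * (1 / n) := by
    rw [← sumaF16, Finset.toLeft_disjSum_toRight]
  set P := S.toLeft with hP
  have hq : 0 ≤ (S.toRight.card : ℝ) * (1 / n) := by positivity
  have hlow : ((Pᶜ.card : ℕ) : ℝ) * (min 1 b * ((1 + epsN n) / n)) ≤
      ∑ i ∈ Sᶜ, min (aF n i) b * ptF n k i := by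
    calc _ = ∑ i ∈ (Pᶜ).disjSum ∅, min (aF n i) b * ptF n k i := by
          rw [Finset.sum_disjSum]; simp [aF, ptF]
      _ ≤ _ := by
          apply Finset.sum_le_sum_of_subset_of_nonneg
          · rintro (i | i) hi
            · simpa [hP] using hi
            · simp at hi
          · rintro (i | i) _ _
            · simp only [aF, ptF, Sum.elim_inl]
              have : 0 ≤ min 1 b := le_min zero_le_one hS.le
              positivity
            · simp only [aF, ptF, Sum.elim_inr]
              have : 0 ≤ min (1 / (n:ℝ)) b := le_min (by positivity) hS.le
              positivity
  refine le_trans ?_ hlow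
  rw [Finset.card_compl, Fintype.card_fin]
  have hP2 : P.card < 2 := by
    have : (P.card : ℝ) < 2 := by linarith
    exact_mod_cast this
  have e1 : (n:ℝ) * ((1 + epsN n) / n) = 1 + epsN n := by field_simp
  rcases (by omega : P.card = 0 ∨ P.card = 1) with h | h
  · rw [h] at hsum ⊢
    simp only [Nat.sub_zero]
    have : (n:ℝ) * (min 1 b * ((1 + epsN n) / n)) = min 1 b * (1 + epsN n) := by
      field_simp
    rw [this]
    rcases le_total 1 b with h1 | h1
    · rw [min_eq_left h1]; push_cast at hsum; linarith
    · rw [min_eq_right h1]; nlinarith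
  · rw [h] at hsum ⊢
    push_cast at hsum
    rw [min_eq_right (by linarith)]
    have key : 1 ≤ ((n - 1 : ℕ) : ℝ) * ((1 + epsN n) / n) := by
      rw [Nat.cast_sub (by omega)]
      push_cast
      have : ((n:ℝ) - 1) * ((1 + epsN n) / n) = 1 + epsN n - (1 + epsN n) * (1 / n) := by
        field_simp
      rw [this, ← he2]
      have h3 : epsN n * epsN n ≤ 1 / 3 := by
        rw [he2]; exact one_div_le_one_div_of_le (by norm_num) hn0
      have h4 : epsN n ≤ 3/5 := by nlinarith
      nlinarith
    nlinarith

lemma pitch16 (n k : ℕ) (hn : (2 * k + 3) ^ 2 ≤ n) (T : Finset (Fin n ⊕ Fin n))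
    (w : Fin n ⊕ Fin n → ℝ) (β : ℝ)
    (hw : ∀ i ∈ T, 0 < w i) (hβ : 0 < β)
    (hval : ∀ u ∈ Fcov n, β ≤ ∑ i ∈ T, w i * u i)
    (hp : pitch T w β ≤ k) :
    β ≤ ∑ i ∈ T, w i * ptF n k i := by
  have hn9 : 9 ≤ n := by nlinarith [Nat.zero_le (k * k), Nat.zero_le k]
  obtain ⟨he0, he1, he2, he3⟩ := eps16 n (by omega)
  have hn0 : (9:ℝ) ≤ n := by exact_mod_cast hn9
  -- extended weights
  obtain ⟨f, hfT, hfN⟩ : ∃ f : Fin n ⊕ Fin n → ℝ, (∀ i ∈ T, f i = w i) ∧ ∀ i ∉ T, f i = 0 :=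
    ⟨fun i => if i ∈ T then w i else 0, fun i hi => by simp [hi], fun i hi => by simp [hi]⟩
  have hf0 : ∀ i, 0 ≤ f i := fun i => by
    by_cases h : i ∈ T
    · rw [hfT i h]; exact (hw i h).le
    · rw [hfN i h]
  have hext : ∀ u : Fin n ⊕ Fin n → ℝ, ∑ i ∈ T, w i * u i = ∑ i, f i * u i := by
    intro u
    rw [← Finset.sum_subset (Finset.subset_univ T) (fun i _ hi => by rw [hfN i hi, zero_mul])]
    exact Finset.sum_congr rfl fun i hi => by rw [hfT i hi]
  have hfeas : ∀ P Q : Finset (Fin n), 1 + epsN n ≤ (P.card : ℝ) + Q.card * (1 / n) →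
      β ≤ ∑ i ∈ P, f (Sum.inl i) + ∑ j ∈ Q, f (Sum.inr j) := by
    intro P Q h
    have := hval (fun i => if i ∈ P.disjSum Q then 1 else 0) ⟨fun i => by
      by_cases h : i ∈ P.disjSum Q <;> simp only [h, if_true, if_false] <;> simp, by
      simp only [mul_ite, mul_one, mul_zero]
      rw [Finset.sum_ite_mem, Finset.univ_inter, sumaF16]; exact h⟩
    rw [hext] at this
    simp only [mul_ite, mul_one, mul_zero] at this
    rw [Finset.sum_ite_mem, Finset.univ_inter, Finset.sum_disjSum] at this
    exact this
  have hpit : ∀ S ⊆ T, S.card = pitch T w β → β ≤ ∑ i ∈ S, w i := by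
    have : pitch T w β ∈ {k : ℕ | ∀ S ⊆ T, S.card = k → β ≤ ∑ i ∈ S, w i} := by
      apply Nat.sInf_mem
      refine ⟨T.card + 1, fun S hS hc => ?_⟩
      have := Finset.card_le_card hS
      omega
    exact this
  set p := pitch T w β
  rw [hext, Fintype.sum_sum_type]
  simp only [ptF, Sum.elim_inl, Sum.elim_inr, ← Finset.sum_mul]
  set X := ∑ i : Fin n, f (Sum.inl i) with hX
  set Z := ∑ j : Fin n, f (Sum.inr j) with hZ
  have hX0 : 0 ≤ X := Finset.sum_nonneg fun _ _ => hf0 _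
  have hZ0 : 0 ≤ Z := Finset.sum_nonneg fun _ _ => hf0 _
  have hZk : 0 ≤ Z * ((k:ℝ) / n) := by positivity
  have e1 : (n:ℝ) * ((1 + epsN n) / n) = 1 + epsN n := by field_simp
  have hc0 : 0 < (1 + epsN n) / n := by positivity
  obtain ⟨i0, -, hmin⟩ := Finset.exists_min_image (Finset.univ : Finset (Fin n))
    (fun i => f (Sum.inl i)) ⟨⟨0, by omega⟩, Finset.mem_univ _⟩
  have hXa : (n:ℝ) * f (Sum.inl i0) ≤ X := by
    have := Finset.card_nsmul_le_sum (Finset.univ : Finset (Fin n)) (fun i => f (Sum.inl i))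
      (f (Sum.inl i0)) (fun i hi => hmin i hi)
    simpa using this
  have ha0 := hf0 (Sum.inl i0)
  set a := f (Sum.inl i0) with ha
  have hXa' : a * (1 + epsN n) ≤ X * ((1 + epsN n) / n) := by
    have := mul_le_mul_of_nonneg_right hXa hc0.le
    have h2 : a * (1 + epsN n) = n * a * ((1 + epsN n) / n) := by field_simp
    rw [h2]; exact this
  by_cases hab : β ≤ a
  · nlinarith
  push Not at hab
  by_cases hi0 : Sum.inl i0 ∈ T
  · -- main case
    set r := Nat.sqrt n with hr
    have hr1 : n < (r + 1) * (r + 1) := Nat.lt_succ_sqrt n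
    have hr2 : r * r ≤ n := Nat.sqrt_le n
    have hr3 : 2 * k + 3 ≤ r := by
      rw [hr, Nat.le_sqrt]; nlinarith
    set A := Finset.univ.filter (fun j : Fin n => Sum.inr j ∈ T) with hA
    have hAc : Aᶜ.card ≤ r := by
      by_contra hcon
      push Not at hcon
      obtain ⟨Q, hQ, hQc⟩ := Finset.exists_subset_card_eq (Nat.succ_le_of_lt hcon)
      have h1 := hfeas {i0} Q (by
        rw [Finset.card_singleton, hQc, ← he2]
        have : Real.sqrt n ≤ (r + 1 : ℕ) := by
          rw [Real.sqrt_le_left (by positivity)]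
          exact_mod_cast (by nlinarith : n ≤ (r+1)^2)
        have h2 : epsN n * Real.sqrt n = 1 := by
          unfold epsN
          have : 0 < Real.sqrt n := Real.sqrt_pos.mpr (by linarith)
          field_simp
        have h3 : 1 ≤ epsN n * ((r + 1 : ℕ) : ℝ) := by
          rw [← h2]; exact mul_le_mul_of_nonneg_left this he0.le
        have h4 := mul_le_mul_of_nonneg_left h3 he0.le
        push_cast at h4 ⊢
        linarith)
      rw [Finset.sum_singleton, Finset.sum_eq_zero (s := Q)] at h1
      · linarith
      · intro j hj
        apply hfN
        have := hQ hj
        simpa [hA] using this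
    have hAt : n ≤ A.card + r := by
      rw [Finset.card_compl, Fintype.card_fin] at hAc
      omega
    have hp0 : p ≠ 0 := by
      intro h
      have := hpit ∅ (Finset.empty_subset _) (by simp [h])
      simp at this
      linarith
    have hchunk : ∀ Q ⊆ A, Q.card = p - 1 → β - a ≤ ∑ j ∈ Q, f (Sum.inr j) := by
      intro Q hQ hQc
      have hsub : ({i0} : Finset (Fin n)).disjSum Q ⊆ T := by
        rintro (i | j) h
        · simp at h; rw [h]; exact hi0
        · simp at h
          have := hQ h
          simpa [hA] using this
      have := hpit _ hsub (by rw [Finset.card_disjSum, hQc, Finset.card_singleton]; omega)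
      rw [Finset.sum_congr rfl (fun i hi => (hfT i (hsub hi)).symm), Finset.sum_disjSum,
        Finset.sum_singleton] at this
      linarith
    have hk : 0 < k := by omega
    have hq1 : n ≤ k * (n / k + 1) := by
      have := Nat.lt_mul_div_succ n hk
      omega
    have hq2 : k * (n / k) ≤ n := Nat.mul_div_le n k
    have hq3 : k + r ≤ n / k := by
      rw [Nat.le_div_iff_mul_le hk]; nlinarith
    have hq4 : (n / k + 1) * (p - 1) ≤ A.card := by
      obtain ⟨k', rfl⟩ : ∃ k', k = k' + 1 := ⟨k - 1, by omega⟩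
      have h1 : (n / (k' + 1) + 1) * (p - 1) ≤ (n / (k' + 1) + 1) * k' :=
        Nat.mul_le_mul_left _ (by omega)
      generalize n / (k' + 1) = d at *
      nlinarith
    have hfin := chunk16 (fun j : Fin n => f (Sum.inr j)) (fun j => hf0 _) (p - 1) (β - a)
      (n / k + 1) A hchunk hq4
    have hAZ : ∑ j ∈ A, f (Sum.inr j) ≤ Z :=
      Finset.sum_le_sum_of_subset_of_nonneg (Finset.subset_univ _) fun _ _ _ => hf0 _
    have hkn : β - a ≤ Z * ((k:ℝ) / n) := by
      rw [← mul_div_assoc, le_div_iff₀ (by linarith)]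
      have h1 : (n:ℝ) ≤ k * ((n / k + 1 : ℕ) : ℝ) := by exact_mod_cast hq1
      have h2 : (β - a) * n ≤ (β - a) * (k * ((n / k + 1 : ℕ) : ℝ)) :=
        mul_le_mul_of_nonneg_left h1 (by linarith)
      have h3 := mul_le_mul_of_nonneg_left (hfin.trans hAZ) (Nat.cast_nonneg (α := ℝ) k)
      linarith
    nlinarith
  · have haz : a = 0 := hfN _ hi0
    have hoth : ∀ i ∈ Finset.univ.erase i0, β ≤ f (Sum.inl i) := by
      intro i hi
      have hne : i ≠ i0 := Finset.ne_of_mem_erase hi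
      have := hfeas {i, i0} ∅ (by rw [Finset.card_pair hne]; simp; linarith)
      rw [Finset.sum_pair hne] at this
      simp at this
      linarith
    have h1 := Finset.card_nsmul_le_sum _ _ _ hoth
    rw [Finset.card_erase_of_mem (Finset.mem_univ _), Finset.card_univ, Fintype.card_fin,
      nsmul_eq_mul] at h1
    have h2 : ∑ i ∈ Finset.univ.erase i0, f (Sum.inl i) ≤ X :=
      Finset.sum_le_sum_of_subset_of_nonneg (Finset.subset_univ _) fun _ _ _ => hf0 _
    have key : 1 ≤ ((n - 1 : ℕ) : ℝ) * ((1 + epsN n) / n) := by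
      rw [Nat.cast_sub (by omega)]
      push_cast
      have : ((n:ℝ) - 1) * ((1 + epsN n) / n) = 1 + epsN n - (1 + epsN n) * (1 / n) := by
        field_simp
      rw [this, ← he2]
      have h3 : epsN n * epsN n ≤ 1 / 3 := by
        rw [he2]; exact one_div_le_one_div_of_le (by norm_num) (by linarith)
      have h4 : epsN n ≤ 3/5 := by nlinarith
      nlinarith
    have h3 := mul_le_mul_of_nonneg_right (h1.trans h2) hc0.le
    have h4 := mul_le_mul_of_nonneg_left key hβ.le
    linarith

lemma mem16 (n k : ℕ) (hn : (2 * k + 3) ^ 2 ≤ n) : ptF n k ∈ RelF n k := by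
  have hn9 : 9 ≤ n := by nlinarith [Nat.zero_le (k * k), Nat.zero_le k]
  obtain ⟨he0, he1, he2, he3⟩ := eps16 n (by omega)
  have hn0 : (9:ℝ) ≤ n := by exact_mod_cast hn9
  refine ⟨?_, ?_, fun S hS => kc16 n k (by omega) S hS,
    fun T w β hw hβ hval hp => pitch16 n k hn T w β hw hβ hval hp⟩
  · rintro (i | i)
    · simp only [ptF, Sum.elim_inl]
      exact ⟨by positivity, by rw [div_le_one (by linarith)]; linarith⟩
    · simp only [ptF, Sum.elim_inr]
      refine ⟨by positivity, ?_⟩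
      rw [div_le_one (by linarith)]
      exact_mod_cast (by nlinarith : k ≤ n)
  · rw [Fintype.sum_sum_type]
    simp only [aF, ptF, Sum.elim_inl, Sum.elim_inr, Finset.sum_const, Finset.card_univ,
      Fintype.card_fin, nsmul_eq_mul, one_mul]
    have e1 : (n:ℝ) * ((1 + epsN n) / n) = 1 + epsN n := by field_simp
    rw [e1]
    have : 0 ≤ (n:ℝ) * (1 / n * (k / n)) := by positivity
    linarith

lemma obj16 (n k : ℕ) (hn : 2 ≤ n) : objF n (ptF n k) = 1 + ((k : ℝ) + 1) / Real.sqrt n := by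
  have hn0 : (2:ℝ) ≤ n := by exact_mod_cast hn
  have : 0 < Real.sqrt n := Real.sqrt_pos.mpr (by linarith)
  simp only [objF, ptF, Sum.elim_inl, Sum.elim_inr, Finset.sum_const, Finset.card_univ,
      Fintype.card_fin, nsmul_eq_mul, epsN]
  field_simp
  ring

lemma low16 (n k : ℕ) (hn : 2 ≤ n) : ∀ r ∈ objF n '' RelF n k, 1 ≤ r := by
  rintro r ⟨v, ⟨hb, hc, -⟩, rfl⟩
  obtain ⟨he0, he1, he2, he3⟩ := eps16 n hn
  rw [Fintype.sum_sum_type] at hc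
  simp only [aF, Sum.elim_inl, Sum.elim_inr, one_mul, ← Finset.mul_sum] at hc
  change 1 ≤ ∑ i : Fin n, v (Sum.inl i) + epsN n * ∑ j : Fin n, v (Sum.inr j)
  have hZ0 : 0 ≤ ∑ j : Fin n, v (Sum.inr j) := Finset.sum_nonneg fun j _ => (hb _).1
  have : 1 / (n:ℝ) ≤ epsN n := by rw [← he2]; nlinarith
  have := mul_le_mul_of_nonneg_right this hZ0
  linarith

theorem stmt_16 (k : ℕ) :
    -- (a) the integer minimum equals 2 for every n ≥ 2
    (∀ n : ℕ, 2 ≤ n → IsLeast {r : ℝ | ∃ v ∈ Fcov n, r = objF n v} 2) ∧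
    -- (b) for all sufficiently large n, the fractional point belongs to the relaxation
    --     given by the constraint, all KC inequalities and all pitch-≤k inequalities,
    ∃ N : ℕ, ∀ n : ℕ, N ≤ n →
      ptF n k ∈ RelF n k ∧
      -- its objective value is 1 + (k+1)/√n,
      objF n (ptF n k) = 1 + ((k : ℝ) + 1) / Real.sqrt n ∧
      -- and consequently the integrality gap of this relaxation is at least
      -- 2/(1 + (k+1)/√n) (which tends to 2)
      2 / (1 + ((k : ℝ) + 1) / Real.sqrt n) ≤ 2 / sInf (objF n '' RelF n k) := by
  refine ⟨fun n hn => partA16 n hn, (2 * k + 3) ^ 2, fun n hn => ?_⟩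
  have hn2 : 2 ≤ n := by nlinarith [Nat.zero_le (k * k), Nat.zero_le k]
  have hm := mem16 n k hn
  have ho := obj16 n k hn2
  refine ⟨hm, ho, ?_⟩
  have h1 : 1 ≤ sInf (objF n '' RelF n k) := le_csInf ⟨_, _, hm, rfl⟩ (low16 n k hn2)
  have h2 : sInf (objF n '' RelF n k) ≤ 1 + ((k : ℝ) + 1) / Real.sqrt n := by
    rw [← ho]
    exact csInf_le ⟨1, fun r hr => low16 n k hn2 r hr⟩ ⟨_, hm, rfl⟩
  exact div_le_div_of_nonneg_left (by norm_num) (by linarith) h2
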